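/- arXiv:math/0509515 — 6 statements merged into one kernel-verified Lean document; each statement's English description precedes it below -/
import Mathlib

section
/- Let g be a real inner product space equipped with a Lie bracket satisfying the invariance condition ⟨[x,y],z⟩ = ⟨x,[y,z]⟩ for all x,y,z ∈ g. Let T₀, T₁, t₀ : [0,1] → g be continuous paths, let t₁ : [0,1] → g be continuously differentiable, and let ρ : [0,1] → g be continuously differentiable with ρ(0) = 0 and ρ(1) = 0. Then ∫₀¹ ( ⟨[ρ(s),T₀(s)] − ρ'(s), t₁(s)⟩ − ⟨[ρ(s),T₁(s)], t₀(s)⟩ ) ds = ∫₀¹ ⟨ρ(s), t₁'(s) + [T₀(s),t₁(s)] + [t₀(s),T₁(s)]⟩ ds. -/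
open scoped RealInnerProductSpace

/-- Integration-by-parts identity showing that the gauge group action on the
complexified path space is Hamiltonian with moment map `μ(T₀,T₁) = T₁' + [T₀,T₁]`. -/
theorem moment_map_integration_by_parts
    {g : Type*} [NormedAddCommGroup g] [InnerProductSpace ℝ g]
    (lie : g →ₗ[ℝ] g →ₗ[ℝ] g)
    (hanti : ∀ x y : g, lie x y = - lie y x)
    (hinv : ∀ x y z : g, ⟪lie x y, z⟫ = ⟪x, lie y z⟫)
    (T₀ T₁ t₀ t₁ ρ t₁' ρ' : ℝ → g)
    (hT₀ : ContinuousOn T₀ (Set.Icc 0 1))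
    (hT₁ : ContinuousOn T₁ (Set.Icc 0 1))
    (ht₀ : ContinuousOn t₀ (Set.Icc 0 1))
    (ht₁ : ∀ s ∈ Set.Icc (0:ℝ) 1, HasDerivWithinAt t₁ (t₁' s) (Set.Icc 0 1) s)
    (ht₁' : ContinuousOn t₁' (Set.Icc 0 1))
    (hρ : ∀ s ∈ Set.Icc (0:ℝ) 1, HasDerivWithinAt ρ (ρ' s) (Set.Icc 0 1) s)
    (hρ' : ContinuousOn ρ' (Set.Icc 0 1))
    (hρ0 : ρ 0 = 0) (hρ1 : ρ 1 = 0) :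
    ∫ s in (0:ℝ)..1,
        (⟪lie (ρ s) (T₀ s) - ρ' s, t₁ s⟫ - ⟪lie (ρ s) (T₁ s), t₀ s⟫)
      = ∫ s in (0:ℝ)..1,
        ⟪ρ s, t₁' s + lie (T₀ s) (t₁ s) + lie (t₀ s) (T₁ s)⟫ := by
  have cρ : ContinuousOn ρ (Set.Icc 0 1) := fun s hs => (hρ s hs).continuousWithinAt
  have ct : ContinuousOn t₁ (Set.Icc 0 1) := fun s hs => (ht₁ s hs).continuousWithinAt
  have hc : ContinuousOn (fun s => ⟪ρ s, t₁' s⟫ + ⟪ρ' s, t₁ s⟫) (Set.Icc (0:ℝ) 1) :=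
    (cρ.inner (𝕜 := ℝ) ht₁').add (hρ'.inner (𝕜 := ℝ) ct)
  have hint : IntervalIntegrable (fun s => ⟪ρ s, t₁' s⟫ + ⟪ρ' s, t₁ s⟫)
      MeasureTheory.volume (0:ℝ) 1 := by
    apply ContinuousOn.intervalIntegrable
    rwa [Set.uIcc_of_le zero_le_one]
  have hzero : ∫ s in (0:ℝ)..1, (⟪ρ s, t₁' s⟫ + ⟪ρ' s, t₁ s⟫) = 0 := by
    rw [intervalIntegral.integral_eq_sub_of_hasDerivAt_of_le zero_le_one
      (f := fun s => ⟪ρ s, t₁ s⟫) (cρ.inner (𝕜 := ℝ) ct) _ hint]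
    · simp [hρ0, hρ1]
    · intro s hs
      have hn : Set.Icc (0:ℝ) 1 ∈ nhds s := Icc_mem_nhds hs.1 hs.2
      have hs' := Set.Ioo_subset_Icc_self hs
      exact ((hρ s hs').hasDerivAt hn).inner ℝ ((ht₁ s hs').hasDerivAt hn)
  have key : (fun s => ⟪ρ s, t₁' s + lie (T₀ s) (t₁ s) + lie (t₀ s) (T₁ s)⟫)
      = fun s => (⟪lie (ρ s) (T₀ s) - ρ' s, t₁ s⟫ - ⟪lie (ρ s) (T₁ s), t₀ s⟫)
        + (⟪ρ s, t₁' s⟫ + ⟪ρ' s, t₁ s⟫) := by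
    funext s
    rw [hanti (t₀ s) (T₁ s), inner_sub_left, hinv, hinv, inner_add_right, inner_add_right,
      inner_neg_right]
    ring
  rw [key]
  by_cases hf : IntervalIntegrable
      (fun s => ⟪lie (ρ s) (T₀ s) - ρ' s, t₁ s⟫ - ⟪lie (ρ s) (T₁ s), t₀ s⟫)
      MeasureTheory.volume (0:ℝ) 1
  · rw [intervalIntegral.integral_add hf hint, hzero, add_zero]
  · -- the bracket need not be continuous: then neither side is integrable
    rw [intervalIntegral.integral_undef hf, intervalIntegral.integral_undef]
    intro h
    apply hf
    have := h.sub hint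
    simpa [Pi.sub_def] using this
end

section
/- Let n ≥ 1 and let T₀, T₁, T₂, T₃ : ℝ → Matrix n n ℂ be differentiable paths with T_i(s)ᴴ = −T_i(s) for every s and i = 0,1,2,3. Set α = T₀ − i·T₁, β = T₂ + i·T₃, and for each ζ ∈ ℂ define A(ζ)(s) = β(s) + (α(s) + α(s)ᴴ)·ζ − β(s)ᴴ·ζ² and B(ζ)(s) = α(s) − β(s)ᴴ·ζ. Then (T₀,T₁,T₂,T₃) satisfies the Nahm equations T₁' + [T₀,T₁] − [T₂,T₃] = 0, T₂' + [T₀,T₂] − [T₃,T₁] = 0, T₃' + [T₀,T₃] − [T₁,T₂] = 0 for all s if and only if for every ζ ∈ ℂ and every s the Lax equation (d/ds) A(ζ)(s) = [A(ζ)(s), B(ζ)(s)] holds, where [X,Y] = XY − YX. -/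
open Matrix

theorem nahm_skew_deriv {n : ℕ} (T T' : ℝ → Matrix (Fin n) (Fin n) ℂ)
    (hd : ∀ s i j, HasDerivAt (fun t => T t i j) (T' s i j) s)
    (hs : ∀ s, (T s)ᴴ = -(T s)) (s : ℝ) : (T' s)ᴴ = -(T' s) := by
  ext i j
  have h1 := (hd s j i).star
  have h2 := (hd s i j).neg
  have e : (fun t => star (T t j i)) = -(fun t => T t i j) := by
    funext t
    have := congrFun (congrFun (hs t) i) j
    simpa [Matrix.conjTranspose_apply] using this
  rw [e] at h1
  have := h1.unique h2
  simpa [Matrix.conjTranspose_apply] using this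

theorem nahm_key {n : ℕ} (a b c d b' c' d' : Matrix (Fin n) (Fin n) ℂ) (ζ : ℂ) :
    ((c' + Complex.I • d') + ζ • ((-2 * Complex.I) • b') - ζ ^ 2 • (-c' + Complex.I • d'))
    - (((c + Complex.I • d) + ζ • ((-2 * Complex.I) • b) - ζ ^ 2 • (-c + Complex.I • d))
        * ((a - Complex.I • b) - ζ • (-c + Complex.I • d))
      - ((a - Complex.I • b) - ζ • (-c + Complex.I • d))
        * ((c + Complex.I • d) + ζ • ((-2 * Complex.I) • b) - ζ ^ 2 • (-c + Complex.I • d)))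
    = ((c' + (a * c - c * a) - (d * b - b * d))
        + Complex.I • (d' + (a * d - d * a) - (b * c - c * b)))
      + ζ • ((-2 * Complex.I) • (b' + (a * b - b * a) - (c * d - d * c)))
      - ζ ^ 2 • (-(c' + (a * c - c * a) - (d * b - b * d))
        + Complex.I • (d' + (a * d - d * a) - (b * c - c * b))) := by
  have hI := Complex.I_sq
  simp only [mul_add, add_mul, mul_sub, sub_mul, smul_mul_assoc, mul_smul_comm, smul_add,
    smul_sub, neg_mul, mul_neg, smul_neg]
  match_scalars <;> first | ring1 | grind

/-- The Nahm equations for skew-hermitian matrix paths are equivalent to the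
ζ-parametrized family of Lax equations `(d/ds) A(ζ) = [A(ζ), B(ζ)]`, where
`A(ζ) = β + (α + αᴴ)ζ - βᴴζ²` and `B(ζ) = α - βᴴζ`, with `α = T₀ - i T₁`,
`β = T₂ + i T₃`. -/
theorem nahm_iff_lax_family
    (n : ℕ) (hn : 1 ≤ n)
    (T₀ T₁ T₂ T₃ T₀' T₁' T₂' T₃' : ℝ → Matrix (Fin n) (Fin n) ℂ)
    (hd₀ : ∀ s i j, HasDerivAt (fun t => T₀ t i j) (T₀' s i j) s)
    (hd₁ : ∀ s i j, HasDerivAt (fun t => T₁ t i j) (T₁' s i j) s)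
    (hd₂ : ∀ s i j, HasDerivAt (fun t => T₂ t i j) (T₂' s i j) s)
    (hd₃ : ∀ s i j, HasDerivAt (fun t => T₃ t i j) (T₃' s i j) s)
    (hskew₀ : ∀ s, (T₀ s)ᴴ = -(T₀ s))
    (hskew₁ : ∀ s, (T₁ s)ᴴ = -(T₁ s))
    (hskew₂ : ∀ s, (T₂ s)ᴴ = -(T₂ s))
    (hskew₃ : ∀ s, (T₃ s)ᴴ = -(T₃ s))
    -- abbreviations
    (α β α' β' : ℝ → Matrix (Fin n) (Fin n) ℂ)
    (hα : α = fun s => T₀ s - Complex.I • T₁ s)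
    (hβ : β = fun s => T₂ s + Complex.I • T₃ s)
    (hα' : α' = fun s => T₀' s - Complex.I • T₁' s)
    (hβ' : β' = fun s => T₂' s + Complex.I • T₃' s)
    (A B dA : ℂ → ℝ → Matrix (Fin n) (Fin n) ℂ)
    (hA : A = fun ζ s => β s + ζ • (α s + (α s)ᴴ) - (ζ ^ 2) • (β s)ᴴ)
    (hB : B = fun ζ s => α s - ζ • (β s)ᴴ)
    (hdA : dA = fun ζ s => β' s + ζ • (α' s + (α' s)ᴴ) - (ζ ^ 2) • (β' s)ᴴ) :
    -- `dA ζ` is indeed the `s`-derivative of `A ζ`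
    (∀ ζ s i j, HasDerivAt (fun t => A ζ t i j) (dA ζ s i j) s) ∧
    -- the equivalence between the Nahm equations and the family of Lax equations
    ((∀ s : ℝ,
        T₁' s + (T₀ s * T₁ s - T₁ s * T₀ s) - (T₂ s * T₃ s - T₃ s * T₂ s) = 0 ∧
        T₂' s + (T₀ s * T₂ s - T₂ s * T₀ s) - (T₃ s * T₁ s - T₁ s * T₃ s) = 0 ∧
        T₃' s + (T₀ s * T₃ s - T₃ s * T₀ s) - (T₁ s * T₂ s - T₂ s * T₁ s) = 0)
      ↔ (∀ (ζ : ℂ) (s : ℝ),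
        dA ζ s = A ζ s * B ζ s - B ζ s * A ζ s)) := by
  have k₀ := nahm_skew_deriv T₀ T₀' hd₀ hskew₀
  have k₁ := nahm_skew_deriv T₁ T₁' hd₁ hskew₁
  have k₂ := nahm_skew_deriv T₂ T₂' hd₂ hskew₂
  have k₃ := nahm_skew_deriv T₃ T₃' hd₃ hskew₃
  have eA : A = fun ζ s => (T₂ s + Complex.I • T₃ s) + ζ • ((-2 * Complex.I) • T₁ s)
      - ζ ^ 2 • (-T₂ s + Complex.I • T₃ s) := by
    rw [hA, hα, hβ]
    funext ζ s
    simp only [conjTranspose_add, conjTranspose_sub, conjTranspose_smul, hskew₀, hskew₁, hskew₂,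
      hskew₃, Complex.star_def, Complex.conj_I]
    module
  have eB : B = fun ζ s => (T₀ s - Complex.I • T₁ s) - ζ • (-T₂ s + Complex.I • T₃ s) := by
    rw [hB, hα, hβ]
    funext ζ s
    simp only [conjTranspose_add, conjTranspose_smul, hskew₂,
      hskew₃, Complex.star_def, Complex.conj_I]
    module
  have edA : dA = fun ζ s => (T₂' s + Complex.I • T₃' s) + ζ • ((-2 * Complex.I) • T₁' s)
      - ζ ^ 2 • (-T₂' s + Complex.I • T₃' s) := by
    rw [hdA, hα', hβ']
    funext ζ s
    simp only [conjTranspose_add, conjTranspose_sub, conjTranspose_smul, k₀, k₁, k₂,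
      k₃, Complex.star_def, Complex.conj_I]
    module
  clear hA hB hdA
  subst eA eB edA
  refine ⟨?_, ?_⟩
  · intro ζ s i j
    simp only [Matrix.add_apply, Matrix.sub_apply, Matrix.smul_apply, Matrix.neg_apply,
      smul_eq_mul]
    exact (((hd₂ s i j).add ((hd₃ s i j).const_mul _)).add
      (((hd₁ s i j).const_mul _).const_mul _)).sub
      ((((hd₂ s i j).neg).add ((hd₃ s i j).const_mul _)).const_mul _)
  · constructor
    · intro h ζ s
      obtain ⟨h1, h2, h3⟩ := h s
      rw [← sub_eq_zero]
      refine (nahm_key _ _ _ _ _ _ _ ζ).trans ?_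
      rw [h1, h2, h3]
      simp
    · intro h s
      have key := fun ζ => (nahm_key (T₀ s) (T₁ s) (T₂ s) (T₃ s) (T₁' s) (T₂' s) (T₃' s) ζ).symm.trans
        (sub_eq_zero.2 (h ζ s))
      have s2 : (T₂' s + (T₀ s * T₂ s - T₂ s * T₀ s) - (T₃ s * T₁ s - T₁ s * T₃ s))ᴴ
        = -(T₂' s + (T₀ s * T₂ s - T₂ s * T₀ s) - (T₃ s * T₁ s - T₁ s * T₃ s)) := by
        simp only [conjTranspose_add, conjTranspose_sub, conjTranspose_mul, hskew₀, hskew₁,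
          hskew₂, hskew₃, k₂]
        noncomm_ring
      have s3 : (T₃' s + (T₀ s * T₃ s - T₃ s * T₀ s) - (T₁ s * T₂ s - T₂ s * T₁ s))ᴴ
        = -(T₃' s + (T₀ s * T₃ s - T₃ s * T₀ s) - (T₁ s * T₂ s - T₂ s * T₁ s)) := by
        simp only [conjTranspose_add, conjTranspose_sub, conjTranspose_mul, hskew₀, hskew₁,
          hskew₂, hskew₃, k₃]
        noncomm_ring
      generalize T₁' s + (T₀ s * T₁ s - T₁ s * T₀ s) - (T₂ s * T₃ s - T₃ s * T₂ s) = X at *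
      generalize T₂' s + (T₀ s * T₂ s - T₂ s * T₀ s) - (T₃ s * T₁ s - T₁ s * T₃ s) = Y at *
      generalize T₃' s + (T₀ s * T₃ s - T₃ s * T₀ s) - (T₁ s * T₂ s - T₂ s * T₁ s) = Z at *
      have e0 : Y + Complex.I • Z = 0 := by simpa using key 0
      have e0' : -Y + Complex.I • Z = 0 := by
        have := congrArg conjTranspose e0
        simpa [conjTranspose_add, conjTranspose_smul, s2, s3] using this
      have hY : Y = 0 := by
        linear_combination (norm := module) (1 / 2 : ℂ) • e0 - (1 / 2 : ℂ) • e0'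
      have hZ : Z = 0 := by
        rw [hY] at e0
        simpa using e0
      have e1 := key 1
      refine ⟨?_, hY, hZ⟩
      rw [hY, hZ] at e1
      simpa using e1
end

section
/- Let n ≥ 1 and let A, B : ℝ → Matrix n n ℂ with A differentiable and satisfying the Lax equation A'(s) = A(s)·B(s) − B(s)·A(s) for all s. Then for every natural number m, the function s ↦ trace(A(s)^m) is constant on ℝ. -/
open Matrix

/-- Along a solution of a Lax equation `A' = [A, B]`, the traces of all powers of `A`
are constant. -/
theorem trace_pow_const_of_lax
    (n : ℕ) (hn : 1 ≤ n)
    (A B A' : ℝ → Matrix (Fin n) (Fin n) ℂ)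
    (hd : ∀ s i j, HasDerivAt (fun t => A t i j) (A' s i j) s)
    (hLax : ∀ s, A' s = A s * B s - B s * A s) :
    ∀ (m : ℕ) (s t : ℝ), (A s ^ m).trace = (A t ^ m).trace := by
  intro m
  have key : ∀ (m : ℕ) (s : ℝ) (i j : Fin n),
      HasDerivAt (fun t => (A t ^ m) i j) ((A s ^ m * B s - B s * A s ^ m) i j) s := by
    intro m
    induction m with
    | zero =>
      intro s i j
      simpa using hasDerivAt_const s ((1 : Matrix (Fin n) (Fin n) ℂ) i j)
    | succ m ih =>
      intro s i j
      have e : A s ^ (m + 1) * B s - B s * A s ^ (m + 1)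
          = (A s ^ m * B s - B s * A s ^ m) * A s + A s ^ m * A' s := by
        rw [hLax, pow_succ]
        noncomm_ring
      have h := HasDerivAt.fun_sum (u := Finset.univ)
        (fun k _ => (ih s i k).fun_mul (hd s k j))
      rw [e]
      simp only [pow_succ]
      simp only [Matrix.add_apply, Matrix.mul_apply (M := A _ ^ m),
        Matrix.mul_apply (M := A s ^ m * B s - B s * A s ^ m), ← Finset.sum_add_distrib]
      simpa only [Matrix.mul_apply (M := A _ ^ m)] using h
  have tr : ∀ s : ℝ, HasDerivAt (fun t => (A t ^ m).trace) 0 s := by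
    intro s
    have h := HasDerivAt.fun_sum (u := Finset.univ) (fun i _ => key m s i i)
    have e : ∑ i, (A s ^ m * B s - B s * A s ^ m) i i = 0 := by
      change (A s ^ m * B s - B s * A s ^ m).trace = 0
      rw [Matrix.trace_sub, Matrix.trace_mul_comm, sub_self]
    rw [e] at h
    exact h
  exact is_const_of_deriv_eq_zero (fun s => (tr s).differentiableAt) (fun s => (tr s).deriv)
end

section
/- Let n ≥ 1, let A, B : ℝ → Matrix n n ℂ with A differentiable and A'(s) = A(s)·B(s) − B(s)·A(s) for all s, and let g : ℝ → Matrix n n ℂ be differentiable with g(0) = 1 (the identity matrix), g(s) invertible for every s, and g'(s) = −B(s)·g(s) for all s. Then A(s) = g(s)·A(0)·g(s)⁻¹ for every s ∈ ℝ. -/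
open Matrix

open scoped Matrix.Norms.Operator in
theorem lax_aux (n : ℕ)
    (A B A' g g' : ℝ → Matrix (Fin n) (Fin n) ℂ)
    (hdA : ∀ s i j, HasDerivAt (fun t => A t i j) (A' s i j) s)
    (hLax : ∀ s, A' s = A s * B s - B s * A s)
    (hdg : ∀ s i j, HasDerivAt (fun t => g t i j) (g' s i j) s)
    (hginv : ∀ s, IsUnit (g s))
    (hgODE : ∀ s, g' s = -(B s * g s)) (s : ℝ) :
    Ring.inverse (g s) * A s * g s = Ring.inverse (g 0) * A 0 * g 0 := by
  have hA : ∀ s, HasDerivAt A (A' s) s := fun s =>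
    hasDerivAt_pi.2 fun i => hasDerivAt_pi.2 fun j => hdA s i j
  have hg : ∀ s, HasDerivAt g (g' s) s := fun s =>
    hasDerivAt_pi.2 fun i => hasDerivAt_pi.2 fun j => hdg s i j
  have hM : ∀ s, HasDerivAt (fun t => Ring.inverse (g t) * A t * g t) 0 s := by
    intro s
    obtain ⟨u, hu⟩ := hginv s
    have h1 := hasFDerivAt_ringInverse (𝕜 := ℝ) u
    rw [hu] at h1
    have h2 := h1.comp_hasDerivAt s (hg s)
    have h3 := (h2.mul (hA s)).mul (hg s)
    refine h3.congr_deriv ?_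
    simp only [Pi.mul_apply, Function.comp, hLax, hgODE, ← hu, Ring.inverse_unit,
      _root_.neg_apply, ContinuousLinearMap.mulLeftRight_apply]
    simp only [mul_neg, neg_mul, neg_neg, mul_assoc, Units.mul_inv_cancel_left, Units.mul_inv,
      mul_one, mul_sub, sub_mul, add_mul]
    abel
  exact is_const_of_deriv_eq_zero (fun s => (hM s).differentiableAt) (fun s => (hM s).deriv) s 0

/-- A solution of a Lax equation `A' = [A, B]` stays in a single conjugacy class:
if `g` solves `g' = -Bg`, `g(0) = 1`, `g(s)` invertible, then `A(s) = g(s) A(0) g(s)⁻¹`. -/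
theorem lax_conjugation
    (n : ℕ) (hn : 1 ≤ n)
    (A B A' g g' : ℝ → Matrix (Fin n) (Fin n) ℂ)
    (hdA : ∀ s i j, HasDerivAt (fun t => A t i j) (A' s i j) s)
    (hLax : ∀ s, A' s = A s * B s - B s * A s)
    (hdg : ∀ s i j, HasDerivAt (fun t => g t i j) (g' s i j) s)
    (hg0 : g 0 = 1)
    (hginv : ∀ s, IsUnit (g s))
    (hgODE : ∀ s, g' s = -(B s * g s)) :
    ∀ s : ℝ, A s = g s * A 0 * (g s)⁻¹ := by
  intro s
  have h := lax_aux n A B A' g g' hdA hLax hdg hginv hgODE s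
  rw [← Matrix.nonsing_inv_eq_ringInverse, ← Matrix.nonsing_inv_eq_ringInverse, hg0] at h
  simp only [inv_one, one_mul, mul_one] at h
  have hd := (Matrix.isUnit_iff_isUnit_det _).1 (hginv s)
  rw [← h]
  simp only [← mul_assoc, Matrix.mul_nonsing_inv _ hd, one_mul]
  rw [mul_assoc, Matrix.mul_nonsing_inv _ hd, mul_one]
end

section
/- Let g be a finite-dimensional real normed vector space equipped with a bilinear Lie bracket [·,·]. Let T₀, T₁, T₂, T₃ : [0,∞) → g be differentiable and satisfy the Nahm equations T₁' + [T₀,T₁] − [T₂,T₃] = 0, T₂' + [T₀,T₂] − [T₃,T₁] = 0, T₃' + [T₀,T₃] − [T₁,T₂] = 0 on [0,∞). Suppose that as s → ∞, T₀(s) → 0 and T_i(s) → τ_i for fixed elements τ₁, τ₂, τ₃ ∈ g (i = 1,2,3). Then [τ₁,τ₂] = 0, [τ₂,τ₃] = 0 and [τ₃,τ₁] = 0. -/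
open Filter

theorem nahm_aux_deriv_lim {g : Type*} [NormedAddCommGroup g] [NormedSpace ℝ g]
    (f f' : ℝ → g) (a L : g)
    (hd : ∀ s ∈ Set.Ici (0:ℝ), HasDerivWithinAt f (f' s) (Set.Ici 0) s)
    (hf : Tendsto f atTop (nhds a)) (hf' : Tendsto f' atTop (nhds L)) : L = 0 := by
  have key : ∀ ε : ℝ, 0 < ε → ‖L‖ ≤ ε := by
    intro ε hε
    obtain ⟨N, hN⟩ := Filter.eventually_atTop.1 (Metric.tendsto_nhds.1 hf' ε hε)
    have hlim : Tendsto (fun s : ℝ => ‖f (s + 1) - f s - L‖) atTop (nhds ‖a - a - L‖) :=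
      (((hf.comp (tendsto_atTop_add_const_right _ 1 tendsto_id)).sub hf).sub_const L).norm
    have hb : ∀ᶠ s : ℝ in atTop, ‖f (s + 1) - f s - L‖ ≤ ε := by
      filter_upwards [Filter.eventually_ge_atTop (max N 0)] with s hs
      have h1 : ∀ x ∈ Set.Ici (max N 0), HasDerivWithinAt (fun x : ℝ => f x - x • L)
          (f' x - (1 : ℝ) • L) (Set.Ici (max N 0)) x := by
        intro x hx
        have hx0 : x ∈ Set.Ici (0:ℝ) := le_trans (le_max_right N 0) hx
        have k1 : HasDerivWithinAt f (f' x) (Set.Ici (max N 0)) x :=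
          (hd x hx0).mono (Set.Ici_subset_Ici.2 (le_max_right N 0))
        have k2 : HasDerivWithinAt (fun x : ℝ => x • L) ((1 : ℝ) • L) (Set.Ici (max N 0)) x :=
          (hasDerivWithinAt_id x _).smul_const L
        exact k1.sub k2
      have h2 : ∀ x ∈ Set.Ici (max N 0), ‖f' x - (1 : ℝ) • L‖ ≤ ε := by
        intro x hx
        have := hN x (le_trans (le_max_left N 0) hx)
        rw [dist_eq_norm] at this
        rw [one_smul]
        exact this.le
      have hs1 : s + 1 ∈ Set.Ici (max N 0) := by
        rw [Set.mem_Ici]; linarith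
      have h := Convex.norm_image_sub_le_of_norm_hasDerivWithin_le h1 h2
        (convex_Ici (max N 0)) (Set.mem_Ici.2 hs) hs1
      have e : f (s + 1) - (s + 1) • L - (f s - s • L) = f (s + 1) - f s - L := by
        rw [add_smul, one_smul]; abel
      rw [e] at h
      simpa using h
    have := le_of_tendsto hlim hb
    simpa using this
  exact norm_le_zero_iff.1 (le_of_forall_pos_le_add fun ε hε => by simpa using key ε hε)

theorem nahm_aux_lie {g : Type*} [NormedAddCommGroup g] [NormedSpace ℝ g]
    [FiniteDimensional ℝ g] (lie : g →ₗ[ℝ] g →ₗ[ℝ] g) {u v : ℝ → g} {a b : g}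
    (hu : Tendsto u atTop (nhds a)) (hv : Tendsto v atTop (nhds b)) :
    Tendsto (fun s => lie (u s) (v s)) atTop (nhds (lie a b)) := by
  have hc : Continuous ((LinearMap.toContinuousLinearMap (𝕜 := ℝ) (E := g) (F' := g)).toLinearMap ∘ₗ lie) :=
    LinearMap.continuous_of_finiteDimensional _
  have h1 := (hc.tendsto a).comp hu
  exact (isBoundedBilinearMap_apply (𝕜 := ℝ) (E := g) (F := g)).continuous.tendsto _ |>.comp
    (h1.prodMk_nhds hv)

theorem nahm_aux_main {g : Type*} [NormedAddCommGroup g] [NormedSpace ℝ g]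
    [FiniteDimensional ℝ g] (lie : g →ₗ[ℝ] g →ₗ[ℝ] g) (T₀ A A' B C : ℝ → g) (a b c : g)
    (hd : ∀ s ∈ Set.Ici (0:ℝ), HasDerivWithinAt A (A' s) (Set.Ici 0) s)
    (heq : ∀ s ∈ Set.Ici (0:ℝ), A' s + lie (T₀ s) (A s) - lie (B s) (C s) = 0)
    (h0 : Tendsto T₀ atTop (nhds 0)) (hA : Tendsto A atTop (nhds a))
    (hB : Tendsto B atTop (nhds b)) (hC : Tendsto C atTop (nhds c)) : lie b c = 0 := by
  refine nahm_aux_deriv_lim A A' a _ hd hA ?_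
  have h := (nahm_aux_lie lie hB hC).sub (nahm_aux_lie lie h0 hA)
  simp only [map_zero, LinearMap.zero_apply, sub_zero] at h
  refine h.congr' ?_
  filter_upwards [Filter.eventually_ge_atTop (0:ℝ)] with s hs
  rw [← sub_eq_zero.1 (heq s hs)]; abel

/-- The limits at infinity of a solution of the Nahm equations on the half-line
pairwise commute. -/
theorem limits_commute_of_nahm_halfline
    {g : Type*} [NormedAddCommGroup g] [NormedSpace ℝ g] [FiniteDimensional ℝ g]
    (lie : g →ₗ[ℝ] g →ₗ[ℝ] g)
    (T₀ T₁ T₂ T₃ T₁' T₂' T₃' : ℝ → g)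
    (hd₁ : ∀ s ∈ Set.Ici (0:ℝ), HasDerivWithinAt T₁ (T₁' s) (Set.Ici 0) s)
    (hd₂ : ∀ s ∈ Set.Ici (0:ℝ), HasDerivWithinAt T₂ (T₂' s) (Set.Ici 0) s)
    (hd₃ : ∀ s ∈ Set.Ici (0:ℝ), HasDerivWithinAt T₃ (T₃' s) (Set.Ici 0) s)
    (heq₁ : ∀ s ∈ Set.Ici (0:ℝ),
      T₁' s + lie (T₀ s) (T₁ s) - lie (T₂ s) (T₃ s) = 0)
    (heq₂ : ∀ s ∈ Set.Ici (0:ℝ),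
      T₂' s + lie (T₀ s) (T₂ s) - lie (T₃ s) (T₁ s) = 0)
    (heq₃ : ∀ s ∈ Set.Ici (0:ℝ),
      T₃' s + lie (T₀ s) (T₃ s) - lie (T₁ s) (T₂ s) = 0)
    (τ₁ τ₂ τ₃ : g)
    (hlim₀ : Tendsto T₀ atTop (nhds 0))
    (hlim₁ : Tendsto T₁ atTop (nhds τ₁))
    (hlim₂ : Tendsto T₂ atTop (nhds τ₂))
    (hlim₃ : Tendsto T₃ atTop (nhds τ₃)) :
    lie τ₁ τ₂ = 0 ∧ lie τ₂ τ₃ = 0 ∧ lie τ₃ τ₁ = 0 := by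
  exact ⟨nahm_aux_main lie T₀ T₃ T₃' T₁ T₂ _ _ _ hd₃ heq₃ hlim₀ hlim₃ hlim₁ hlim₂,
    nahm_aux_main lie T₀ T₁ T₁' T₂ T₃ _ _ _ hd₁ heq₁ hlim₀ hlim₁ hlim₂ hlim₃,
    nahm_aux_main lie T₀ T₂ T₂' T₃ T₁ _ _ _ hd₂ heq₂ hlim₀ hlim₂ hlim₃ hlim₁⟩
end

section
/- Let n ≥ 1 and let T : ℝ → Matrix n n ℝ be continuous. Then there exists a differentiable map g : ℝ → Matrix n n ℝ such that g(0) = 1 (identity matrix), g'(s) = g(s)·T(s) for all s ∈ ℝ, and g(s) is invertible for every s. Moreover g is unique: any differentiable h : ℝ → Matrix n n ℝ with h(0) = 1 and h'(s) = h(s)·T(s) for all s equals g. -/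
open Matrix

/-- Picard iterates of the linear ODE. -/
noncomputable def picIter {E : Type*} [NormedAddCommGroup E] [NormedSpace ℝ E]
    (A : ℝ → E →L[ℝ] E) (c : E) : ℕ → ℝ → E
  | 0 => fun _ => c
  | k + 1 => fun t => ∫ s in (0 : ℝ)..t, A s (picIter A c k s)

theorem picIter_cont {E : Type*} [NormedAddCommGroup E] [NormedSpace ℝ E] [CompleteSpace E]
    (A : ℝ → E →L[ℝ] E) (hA : Continuous A) (c : E) (k : ℕ) : Continuous (picIter A c k) := by
  induction k with
  | zero => exact continuous_const
  | succ k ih =>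
    have h : Continuous fun s => A s (picIter A c k s) := hA.clm_apply ih
    exact intervalIntegral.continuous_primitive (fun a b => h.intervalIntegrable a b) 0

theorem picIter_deriv {E : Type*} [NormedAddCommGroup E] [NormedSpace ℝ E] [CompleteSpace E]
    (A : ℝ → E →L[ℝ] E) (hA : Continuous A) (c : E) (k : ℕ) (t : ℝ) :
    HasDerivAt (picIter A c (k + 1)) (A t (picIter A c k t)) t := by
  have h : Continuous fun s => A s (picIter A c k s) := hA.clm_apply (picIter_cont A hA c k)
  exact intervalIntegral.integral_hasDerivAt_right (h.intervalIntegrable 0 t)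
    (h.stronglyMeasurableAtFilter _ _) h.continuousAt

theorem picIter_bound {E : Type*} [NormedAddCommGroup E] [NormedSpace ℝ E] [CompleteSpace E]
    (A : ℝ → E →L[ℝ] E) (hA : Continuous A) (c : E) (R M : ℝ) (hM : 0 ≤ M)
    (hAM : ∀ t, |t| ≤ R → ‖A t‖ ≤ M) (k : ℕ) :
    ∀ t, |t| ≤ R → ‖picIter A c k t‖ ≤ ‖c‖ * M ^ k / (k.factorial : ℝ) * |t| ^ k := by
  induction k with
  | zero => intro t _; simp [picIter]
  | succ k ih =>
    intro t ht
    have h : Continuous fun s => A s (picIter A c k s) := hA.clm_apply (picIter_cont A hA c k)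
    have h1 : ‖picIter A c (k + 1) t‖ ≤ ∫ s in Set.uIoc 0 t, ‖A s (picIter A c k s)‖ :=
      intervalIntegral.norm_integral_le_integral_norm_uIoc
    refine h1.trans ?_
    have h2 : ∫ s in Set.uIoc 0 t, ‖A s (picIter A c k s)‖ ≤
        ∫ s in Set.uIoc 0 t, (‖c‖ * M ^ (k + 1) / (k.factorial : ℝ)) * |s - 0| ^ k := by
      apply MeasureTheory.setIntegral_mono_on
      · exact (intervalIntegrable_iff.1 (h.norm.intervalIntegrable 0 t))
      · exact (intervalIntegrable_iff.1 (Continuous.intervalIntegrable (by fun_prop) 0 t))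
      · exact measurableSet_uIoc
      · intro s hs
        have hs' : |s| ≤ R := by
          refine le_trans ?_ ht
          have := Set.abs_sub_left_of_mem_uIcc (Set.uIoc_subset_uIcc hs)
          simpa using this
        calc ‖A s (picIter A c k s)‖ ≤ ‖A s‖ * ‖picIter A c k s‖ := (A s).le_opNorm _
          _ ≤ M * (‖c‖ * M ^ k / (k.factorial : ℝ) * |s| ^ k) := by
            gcongr
            · exact hAM s hs'
            · exact ih s hs'
          _ = _ := by rw [sub_zero]; ring
    refine h2.trans (le_of_eq ?_)
    rw [MeasureTheory.integral_const_mul, integral_pow_abs_sub_uIoc, Nat.factorial_succ]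
    have : (k.factorial : ℝ) ≠ 0 := by positivity
    push_cast
    rw [sub_zero]
    field_simp

theorem linODE_exists {E : Type*} [NormedAddCommGroup E] [NormedSpace ℝ E] [CompleteSpace E]
    (A : ℝ → E →L[ℝ] E) (hA : Continuous A) (c : E) :
    ∃ x : ℝ → E, x 0 = c ∧ ∀ t, HasDerivAt x (A t (x t)) t := by
  have key : ∀ R : ℝ, 0 < R → ∃ u : ℕ → ℝ, Summable u ∧ ∃ M : ℝ, 0 ≤ M ∧
      ∀ t, |t| ≤ R → ‖A t‖ ≤ M ∧ ∀ k, ‖picIter A c k t‖ ≤ u k := by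
    intro R hR
    obtain ⟨M, hM⟩ := (isCompact_Icc (a := -R) (b := R)).exists_bound_of_continuousOn
      hA.continuousOn
    have hM0 : 0 ≤ M := (norm_nonneg _).trans (hM 0 ⟨by linarith, by linarith⟩)
    have hAM : ∀ t, |t| ≤ R → ‖A t‖ ≤ M := fun t ht => hM t (abs_le.1 ht)
    refine ⟨fun k => ‖c‖ * ((M * R) ^ k / (k.factorial : ℝ)),
      (Real.summable_pow_div_factorial (M * R)).mul_left _, M, hM0, fun t ht => ⟨hAM t ht, ?_⟩⟩
    intro k
    refine (picIter_bound A hA c R M hM0 hAM k t ht).trans ?_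
    calc ‖c‖ * M ^ k / (k.factorial : ℝ) * |t| ^ k
        ≤ ‖c‖ * M ^ k / (k.factorial : ℝ) * R ^ k := by gcongr
      _ = _ := by simp only [mul_pow]; ring
  have hsum : ∀ t, Summable fun k => picIter A c k t := by
    intro t
    obtain ⟨u, hu, M, -, h⟩ := key (|t| + 1) (by positivity)
    exact Summable.of_norm_bounded hu (fun k => (h t (by linarith)).2 k)
  have hz : ∀ k, picIter A c (k + 1) 0 = 0 := by intro k; simp [picIter]
  have hx : ∀ t, ∑' k, picIter A c k t = c + ∑' k, picIter A c (k + 1) t := by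
    intro t
    rw [(hsum t).tsum_eq_zero_add]; rfl
  refine ⟨fun t => ∑' k, picIter A c k t, ?_, ?_⟩
  · show ∑' k, picIter A c k 0 = c
    rw [hx]; simp [hz]
  · intro t
    obtain ⟨u, hu, M, hM, h⟩ := key (|t| + 1) (by positivity)
    have hd := hasDerivAt_tsum_of_isPreconnected (𝕜 := ℝ)
      (g := fun k => picIter A c (k + 1)) (g' := fun k s => A s (picIter A c k s))
      (hu.mul_left M) (t := Set.Ioo (-(|t| + 1)) (|t| + 1)) isOpen_Ioo isPreconnected_Ioo
      (fun k s _ => picIter_deriv A hA c k s)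
      (fun k s hs => by
        have hs' := h s (abs_le.2 ⟨hs.1.le, hs.2.le⟩)
        exact ((A s).le_opNorm _).trans
          (mul_le_mul hs'.1 (hs'.2 k) (norm_nonneg _) hM))
      (y₀ := 0) (y := t) ⟨by linarith [abs_nonneg t], by linarith [abs_nonneg t]⟩
      (by simp [hz])
      ⟨by linarith [neg_abs_le t], by linarith [le_abs_self t]⟩
    have h3 : (fun t => ∑' k, picIter A c k t) = fun t => c + ∑' k, picIter A c (k + 1) t :=
      funext hx
    rw [(A t).map_tsum (hsum t), h3]
    exact hd.const_add c

attribute [local instance] Matrix.linftyOpNormedRing Matrix.linftyOpNormedAlgebra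

theorem matODE_entries {n : ℕ} (g : ℝ → Matrix (Fin n) (Fin n) ℝ)
    (g' : Matrix (Fin n) (Fin n) ℝ) (s : ℝ) :
    HasDerivAt g g' s ↔ ∀ i j, HasDerivAt (fun t => g t i j) (g' i j) s := by
  constructor
  · intro h i j
    exact hasDerivAt_pi.1 (hasDerivAt_pi.1 h i) j
  · intro h
    exact hasDerivAt_pi.2 fun i => hasDerivAt_pi.2 fun j => h i j

theorem matODE_inv {n : ℕ} (T g k : ℝ → Matrix (Fin n) (Fin n) ℝ)
    (g0 : g 0 = 1) (k0 : k 0 = 1) (hg : ∀ s, HasDerivAt g (g s * T s) s)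
    (hk : ∀ s, HasDerivAt k (-(T s * k s)) s) (s : ℝ) : g s * k s = 1 := by
  have hd : ∀ s, HasDerivAt (fun s => g s * k s) 0 s := by
    intro s
    have := (hg s).mul (hk s)
    have e : g s * T s * k s + g s * -(T s * k s) = 0 := by
      rw [mul_neg, mul_assoc, add_neg_cancel]
    rw [e] at this
    exact this
  have := is_const_of_deriv_eq_zero (fun s => (hd s).differentiableAt) (fun s => (hd s).deriv) s 0
  simpa [g0, k0] using this

/-- Global existence, uniqueness and invertibility of the solution of the linear matrix
ODE `g' = gT`, `g(0) = 1`. -/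
theorem gauge_transformation_exists_unique
    (n : ℕ) (hn : 1 ≤ n)
    (T : ℝ → Matrix (Fin n) (Fin n) ℝ) (hT : Continuous T) :
    ∃ g : ℝ → Matrix (Fin n) (Fin n) ℝ,
      g 0 = 1 ∧
      (∀ s i j, HasDerivAt (fun t => g t i j) ((g s * T s) i j) s) ∧
      (∀ s, IsUnit (g s)) ∧
      (∀ h : ℝ → Matrix (Fin n) (Fin n) ℝ,
        h 0 = 1 →
        (∀ s i j, HasDerivAt (fun t => h t i j) ((h s * T s) i j) s) →
        h = g) := by
  obtain ⟨g, g0, hg⟩ := linODE_exists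
    (fun s => (ContinuousLinearMap.mul ℝ (Matrix (Fin n) (Fin n) ℝ)).flip (T s))
    ((ContinuousLinearMap.continuous _).comp hT) 1
  obtain ⟨k, k0, hk⟩ := linODE_exists
    (fun s => -(ContinuousLinearMap.mul ℝ (Matrix (Fin n) (Fin n) ℝ)) (T s))
    ((ContinuousLinearMap.continuous _).comp hT).neg 1
  have hg' : ∀ s, HasDerivAt g (g s * T s) s := hg
  have hk' : ∀ s, HasDerivAt k (-(T s * k s)) s := hk
  have hgk := matODE_inv T g k g0 k0 hg' hk'
  refine ⟨g, g0, fun s => (matODE_entries g _ s).1 (hg' s), fun s => ?_, ?_⟩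
  · exact IsUnit.of_mul_eq_one _ (hgk s)
  · intro h h0 hh
    have hhk := matODE_inv T h k h0 k0 (fun s => (matODE_entries h _ s).2 (hh s)) hk'
    funext s
    have hkg : k s * g s = 1 := mul_eq_one_comm.1 (hgk s)
    calc h s = h s * (k s * g s) := by rw [hkg, mul_one]
      _ = g s := by rw [← mul_assoc, hhk, one_mul]
end
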